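/- arXiv:0908.4012 — 4 statements merged into one kernel-verified Lean document; each statement's English description precedes it below -/
import Mathlib

section
/- Let X be a bounded open subset of ℝ². There exists a constant C (depending only on X) such that for every x ∈ X, every a in the closure of X, and every unit vector v' ∈ ℝ², ∫_X |ln( |z−a| − (z−a)·v' )| / |x−z| dz ≤ C. -/
open MeasureTheory Real Set RealInnerProductSpace

open scoped ENNReal

/-- The function `|u| ^ (-3/4)` on `[-R, R]`, equal to `∞` at the origin and to `0` outside. -/
noncomputable def truncatedKernel (R : ℝ) : ℝ → ℝ≥0∞ :=
  (Icc (-R) R).indicator fun u => ENNReal.ofReal |u| ^ (-(3 / 4) : ℝ)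

lemma measurable_truncatedKernel (R : ℝ) : Measurable (truncatedKernel R) :=
  Measurable.indicator (by fun_prop) measurableSet_Icc

lemma truncatedKernel_zero {R : ℝ} (hR : 0 ≤ R) : truncatedKernel R 0 = ⊤ := by
  rw [truncatedKernel, indicator_of_mem (by simpa using hR)]
  simp

lemma truncatedKernel_of_ne_zero {R u : ℝ} (h : |u| ≤ R) (hu : u ≠ 0) :
    truncatedKernel R u = ENNReal.ofReal (|u| ^ (-(3 / 4) : ℝ)) := by
  rw [truncatedKernel, indicator_of_mem (mem_Icc.2 (abs_le.1 h)),
    ENNReal.ofReal_rpow_of_pos (abs_pos.2 hu)]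

lemma truncatedKernel_ne_zero {R u : ℝ} (h : |u| ≤ R) : truncatedKernel R u ≠ 0 := by
  rw [truncatedKernel, indicator_of_mem (mem_Icc.2 (abs_le.1 h))]
  norm_num [ENNReal.rpow_eq_zero_iff]

lemma lintegral_truncatedKernel_lt_top {R : ℝ} (hR : 0 ≤ R) :
    ∫⁻ u, truncatedKernel R u < ⊤ := by
  have hpos : IntervalIntegrable (fun u : ℝ => |u| ^ (-(3 / 4) : ℝ)) volume 0 R := by
    refine (intervalIntegral.intervalIntegrable_rpow' (r := -(3 / 4)) (by norm_num)).congr ?_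
    intro u hu
    rw [uIoc_of_le hR] at hu
    simp [abs_of_pos hu.1]
  have hneg : IntervalIntegrable (fun u : ℝ => |u| ^ (-(3 / 4) : ℝ)) volume (-R) 0 := by
    simpa using ((IntervalIntegrable.iff_comp_neg (by simp)).1 hpos).symm
  have hint : IntegrableOn (fun u : ℝ => |u| ^ (-(3 / 4) : ℝ)) (Icc (-R) R) := by
    rw [integrableOn_Icc_iff_integrableOn_Ioc,
      ← intervalIntegrable_iff_integrableOn_Ioc_of_le (by linarith)]
    exact hneg.trans hpos
  rw [truncatedKernel, lintegral_indicator measurableSet_Icc]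
  refine lt_of_eq_of_lt (lintegral_congr_ae ?_) hint.lintegral_lt_top
  filter_upwards [ae_restrict_of_ae (Measure.ae_ne volume (0 : ℝ))] with u hu
  exact ENNReal.ofReal_rpow_of_pos (abs_pos.2 hu)

lemma abs_log_le_rpow {t M : ℝ} (ht : 0 < t) (htM : t ≤ M) :
    |log t| ≤ 4 * (1 + M ^ (1 / 2 : ℝ)) * t ^ (-(1 / 4) : ℝ) := by
  have hsplit : t ^ (1 / 4 : ℝ) = t ^ (1 / 2 : ℝ) * t ^ (-(1 / 4) : ℝ) := by
    rw [← rpow_add ht]; norm_num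
  have hle : t ^ (1 / 4 : ℝ) ≤ M ^ (1 / 2 : ℝ) * t ^ (-(1 / 4) : ℝ) := by
    rw [hsplit]; gcongr
  have hup := log_le_rpow_div ht.le (ε := 1 / 4) (by norm_num)
  have hlow := log_le_rpow_div (inv_pos.2 ht).le (ε := 1 / 4) (by norm_num)
  rw [log_inv, inv_rpow ht.le, ← rpow_neg ht.le] at hlow
  have h1 : 0 ≤ t ^ (-(1 / 4) : ℝ) := by positivity
  have h2 : 0 ≤ M ^ (1 / 2 : ℝ) * t ^ (-(1 / 4) : ℝ) := by
    have := ht.le.trans htM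
    positivity
  rw [abs_le]
  constructor <;> nlinarith

lemma abs_log_norm_sub_le {n s y M : ℝ} (hn : 0 ≤ n) (hnM : n ≤ M) (hy : y ≠ 0)
    (h : n ^ 2 = s ^ 2 + y ^ 2) :
    |log (n - s)| ≤
      4 * (1 + (2 * M) ^ (1 / 2 : ℝ)) * (2 * M) ^ (1 / 4 : ℝ) * |y| ^ (-(1 / 2) : ℝ) := by
  have hy2 : 0 < y ^ 2 := by positivity
  have hsn : |s| < n := abs_lt_of_sq_lt_sq (by linarith) hn
  obtain ⟨hs1, hs2⟩ := abs_lt.1 hsn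
  have hM : 0 < 2 * M := by linarith
  have ht : 0 < n - s := by linarith
  have hlow : y ^ 2 / (2 * M) ≤ n - s := by
    rw [div_le_iff₀ hM]
    nlinarith
  have hpow : (n - s) ^ (-(1 / 4) : ℝ) ≤ (2 * M) ^ (1 / 4 : ℝ) * |y| ^ (-(1 / 2) : ℝ) := by
    refine (rpow_le_rpow_of_nonpos (by positivity) hlow (by norm_num)).trans_eq ?_
    rw [div_rpow hy2.le hM.le, rpow_neg hM.le, div_inv_eq_mul, mul_comm, ← sq_abs,
      ← rpow_natCast, ← rpow_mul (abs_nonneg y)]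
    norm_num
  rw [mul_assoc]
  refine (abs_log_le_rpow ht (by linarith : n - s ≤ 2 * M)).trans ?_
  gcongr

lemma inv_le_rpow_mul_rpow {n p q : ℝ} (hp : 0 < p) (hq : 0 < q) (hpn : p ≤ n) (hqn : q ≤ n) :
    n⁻¹ ≤ p ^ (-(3 / 4) : ℝ) * q ^ (-(1 / 4) : ℝ) := by
  have hn : 0 < n := hp.trans_le hpn
  have hsplit : n⁻¹ = n ^ (-(3 / 4) : ℝ) * n ^ (-(1 / 4) : ℝ) := by
    rw [← rpow_add hn, ← rpow_neg_one]; norm_num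
  rw [hsplit]
  exact mul_le_mul (rpow_le_rpow_of_nonpos hp hpn (by norm_num))
    (rpow_le_rpow_of_nonpos hq hqn (by norm_num)) (by positivity) (by positivity)

lemma rpow_mul_rpow_le_add {q r : ℝ} (hq : 0 < q) (hr : 0 < r) :
    q ^ (-(1 / 4) : ℝ) * r ^ (-(1 / 2) : ℝ) ≤ q ^ (-(3 / 4) : ℝ) + r ^ (-(3 / 4) : ℝ) := by
  have hsplit : ∀ {m : ℝ}, 0 < m →
      m ^ (-(3 / 4) : ℝ) = m ^ (-(1 / 4) : ℝ) * m ^ (-(1 / 2) : ℝ) := fun hm => by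
    rw [← rpow_add hm]; norm_num
  rcases le_total q r with hqr | hrq
  · refine le_add_of_le_of_nonneg ?_ (by positivity)
    rw [hsplit hq]
    exact mul_le_mul_of_nonneg_left (rpow_le_rpow_of_nonpos hq hqr (by norm_num)) (by positivity)
  · refine le_add_of_nonneg_of_le (by positivity) ?_
    rw [hsplit hr]
    exact mul_le_mul_of_nonneg_right (rpow_le_rpow_of_nonpos hr hrq (by norm_num)) (by positivity)

lemma exists_orthonormalBasis_apply_zero_eq (v : EuclideanSpace ℝ (Fin 2)) (hv : ‖v‖ = 1) :
    ∃ b : OrthonormalBasis (Fin 2) ℝ (EuclideanSpace ℝ (Fin 2)), b 0 = v := by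
  have horth : Orthonormal ℝ (({0} : Set (Fin 2)).domRestrict fun _ => v) :=
    ⟨fun _ => hv, fun i j hij => (hij (Subsingleton.elim i j)).elim⟩
  obtain ⟨b, hb⟩ := horth.exists_orthonormalBasis_extension_of_card_eq (by simp)
  exact ⟨b, hb 0 rfl⟩

lemma measurePreserving_coordinates
    (b : OrthonormalBasis (Fin 2) ℝ (EuclideanSpace ℝ (Fin 2))) :
    MeasurePreserving (fun z => ((⟪b 0, z⟫, ⟪b 1, z⟫) : ℝ × ℝ)) := by
  have h := ((volume_preserving_finTwoArrow ℝ).comp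
    (PiLp.volume_preserving_ofLp (Fin 2))).comp b.measurePreserving_repr
  have hcomp : (fun z => ((⟪b 0, z⟫, ⟪b 1, z⟫) : ℝ × ℝ)) =
      (MeasurableEquiv.finTwoArrow ∘ WithLp.ofLp) ∘ b.repr := by
    ext z <;> simp [MeasurableEquiv.finTwoArrow, b.repr_apply_apply]
  rw [hcomp]
  exact h

lemma norm_sq_eq_coordinates (b : OrthonormalBasis (Fin 2) ℝ (EuclideanSpace ℝ (Fin 2)))
    (z : EuclideanSpace ℝ (Fin 2)) : ‖z‖ ^ 2 = ⟪b 0, z⟫ ^ 2 + ⟪b 1, z⟫ ^ 2 := by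
  rw [← b.sum_sq_norm_inner_right z]
  simp [Fin.sum_univ_two]

/-- The constant in the pointwise bound of the integrand by one-dimensional kernels. -/
noncomputable def logKernelConst (M : ℝ) : ℝ :=
  4 * (1 + (2 * M) ^ (1 / 2 : ℝ)) * (2 * M) ^ (1 / 4 : ℝ)

lemma logKernelConst_pos {M : ℝ} (hM : 0 < M) : 0 < logKernelConst M := by
  unfold logKernelConst
  positivity

lemma ofReal_abs_log_div_le (b : OrthonormalBasis (Fin 2) ℝ (EuclideanSpace ℝ (Fin 2))) {M : ℝ}
    (hM : 0 < M) {x a z : EuclideanSpace ℝ (Fin 2)} (hza : ‖z - a‖ ≤ M) (hzx : ‖z - x‖ ≤ M) :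
    ENNReal.ofReal (|log (‖z - a‖ - ⟪z - a, b 0⟫)| / ‖x - z‖) ≤
      ENNReal.ofReal (logKernelConst M) * (truncatedKernel M (⟪b 0, z⟫ - ⟪b 0, x⟫) *
        (truncatedKernel M (⟪b 1, z⟫ - ⟪b 1, x⟫) + truncatedKernel M (⟪b 1, z⟫ - ⟪b 1, a⟫))) := by
  have hC := logKernelConst_pos hM
  have hcoord : ∀ (i : Fin 2) (w : EuclideanSpace ℝ (Fin 2)), |⟪b i, w⟫| ≤ ‖w‖ := fun i w => by
    simpa using abs_real_inner_le_norm (b i) w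
  simp only [← inner_sub_right]
  rw [real_inner_comm (b 0) (z - a), norm_sub_rev x]
  have hp := hcoord 0 (z - x)
  have hq := hcoord 1 (z - x)
  have hr := (hcoord 1 (z - a)).trans hza
  have hsq := norm_sq_eq_coordinates b (z - a)
  set p := ⟪b 0, z - x⟫
  set q := ⟪b 1, z - x⟫
  set r := ⟪b 1, z - a⟫
  have hp0 := truncatedKernel_ne_zero (hp.trans hzx)
  have hC0 : ENNReal.ofReal (logKernelConst M) ≠ 0 := by simpa using hC
  by_cases hrz : r = 0
  · simp [hrz, truncatedKernel_zero hM.le, ENNReal.mul_top, hp0, hC0]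
  by_cases hqz : q = 0
  · simp [hqz, truncatedKernel_zero hM.le, ENNReal.mul_top, hp0, hC0]
  by_cases hpz : p = 0
  · have hq0 := truncatedKernel_ne_zero (hq.trans hzx)
    simp [hpz, truncatedKernel_zero hM.le, ENNReal.mul_top, ENNReal.top_mul, hq0, hC0]
  rw [truncatedKernel_of_ne_zero (hp.trans hzx) hpz, truncatedKernel_of_ne_zero (hq.trans hzx) hqz,
    truncatedKernel_of_ne_zero hr hrz, ← ENNReal.ofReal_add (by positivity) (by positivity),
    ← ENNReal.ofReal_mul (by positivity), ← ENNReal.ofReal_mul hC.le]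
  apply ENNReal.ofReal_le_ofReal
  have hlog : |log (‖z - a‖ - ⟪b 0, z - a⟫)| ≤ logKernelConst M * |r| ^ (-(1 / 2) : ℝ) :=
    abs_log_norm_sub_le (norm_nonneg _) hza hrz hsq
  have hinv := inv_le_rpow_mul_rpow (abs_pos.2 hpz) (abs_pos.2 hqz) hp hq
  have hadd := rpow_mul_rpow_le_add (abs_pos.2 hqz) (abs_pos.2 hrz)
  rw [div_eq_mul_inv]
  calc _ ≤ (logKernelConst M * |r| ^ (-(1 / 2) : ℝ)) *
        (|p| ^ (-(3 / 4) : ℝ) * |q| ^ (-(1 / 4) : ℝ)) := by gcongr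
    _ = logKernelConst M * (|p| ^ (-(3 / 4) : ℝ) *
        (|q| ^ (-(1 / 4) : ℝ) * |r| ^ (-(1 / 2) : ℝ))) := by ring
    _ ≤ _ := by gcongr

open MeasureTheory Real Set RealInnerProductSpace

/-- For a bounded open `X ⊂ ℝ²` there is a constant `C` such that for every `x ∈ X`,
`a ∈ closure X` and unit vector `v'`,
`∫_X |ln(|z−a| − (z−a)·v')|/|x−z| dz ≤ C`. -/
theorem bounded_log_singular_integral (X : Set (EuclideanSpace ℝ (Fin 2)))
    (hXo : IsOpen X) (hXb : Bornology.IsBounded X) :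
    ∃ C : ℝ, ∀ x ∈ X, ∀ a ∈ closure X, ∀ v' : EuclideanSpace ℝ (Fin 2), ‖v'‖ = 1 →
      ∫⁻ z in X,
          ENNReal.ofReal (|Real.log (‖z - a‖ - ⟪z - a, v'⟫)| / ‖x - z‖) ≤
        ENNReal.ofReal C := by
  obtain ⟨R, hR, hXR⟩ := hXb.subset_closedBall_lt 0 0
  have hclosure : closure X ⊆ Metric.closedBall 0 R :=
    closure_minimal hXR Metric.isClosed_closedBall
  set M := R + R
  have hM : 0 < M := by positivity
  have hdist : ∀ {z w}, z ∈ X → w ∈ closure X → ‖z - w‖ ≤ M := fun {z w} hz hw =>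
    (norm_sub_le z w).trans
      (add_le_add (by simpa using hXR hz) (by simpa using hclosure hw))
  set I := ∫⁻ u, truncatedKernel M u
  have hI : I ≠ ⊤ := (lintegral_truncatedKernel_lt_top hM.le).ne
  refine ⟨(ENNReal.ofReal (logKernelConst M) * (I * (I + I))).toReal, ?_⟩
  intro x hx a ha v hv
  rw [ENNReal.ofReal_toReal (by finiteness)]
  obtain ⟨b, rfl⟩ := exists_orthonormalBasis_apply_zero_eq v hv
  have hK : ∀ c, Measurable fun u => truncatedKernel M (u - c) := fun c =>
    (measurable_truncatedKernel M).comp (measurable_id.sub_const c)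
  let F : ℝ × ℝ → ℝ≥0∞ := fun w => ENNReal.ofReal (logKernelConst M) *
    (truncatedKernel M (w.1 - ⟪b 0, x⟫) *
      (truncatedKernel M (w.2 - ⟪b 1, x⟫) + truncatedKernel M (w.2 - ⟪b 1, a⟫)))
  have hprod : Measurable fun w : ℝ × ℝ => truncatedKernel M (w.1 - ⟪b 0, x⟫) *
      (truncatedKernel M (w.2 - ⟪b 1, x⟫) + truncatedKernel M (w.2 - ⟪b 1, a⟫)) :=
    ((hK _).comp measurable_fst).mul
      (((hK _).comp measurable_snd).add ((hK _).comp measurable_snd))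
  have hF : Measurable F := hprod.const_mul _
  calc _ ≤ ∫⁻ z in X, F (⟪b 0, z⟫, ⟪b 1, z⟫) := setLIntegral_mono' hXo.measurableSet fun z hz =>
        ofReal_abs_log_div_le b hM (hdist hz ha) (hdist hz (subset_closure hx))
    _ ≤ ∫⁻ z, F (⟪b 0, z⟫, ⟪b 1, z⟫) := setLIntegral_le_lintegral _ _
    _ = ∫⁻ w, F w := (measurePreserving_coordinates b).lintegral_comp hF
    _ = ENNReal.ofReal (logKernelConst M) * (I * (I + I)) := by
      rw [lintegral_const_mul _ hprod, Measure.volume_eq_prod,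
        lintegral_prod_mul (hK _).aemeasurable
          (g := fun u => truncatedKernel M (u - ⟪b 1, x⟫) + truncatedKernel M (u - ⟪b 1, a⟫))
          ((hK _).add (hK _)).aemeasurable,
        lintegral_add_left (hK _), lintegral_sub_right_eq_self, lintegral_sub_right_eq_self,
        lintegral_sub_right_eq_self]
end

section
/- Let n ≥ 3 be an integer and let X be a bounded open subset of ℝⁿ. There exists a constant C (depending only on n and the diameter of X) such that for every x ∈ X, every x' in the closure of X, and every unit vector v' ∈ ℝⁿ, ∫_X |ln |(z−x')_⊥|| / |x−z|^{n−1} dz ≤ C, where (z−x')_⊥ := (z−x') − ((z−x')·v')v'. -/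
open MeasureTheory Real Set RealInnerProductSpace

/-- Negative powers of the norm are integrable on balls, below the dimension. -/
theorem lintegral_ball_enorm_rpow_neg_lt_top {E : Type*} [NormedAddCommGroup E] [NormedSpace ℝ E]
    [FiniteDimensional ℝ E] [MeasurableSpace E] [BorelSpace E] (μ : Measure E)
    [μ.IsAddHaarMeasure] (hd : 1 ≤ Module.finrank ℝ E) {α : ℝ}
    (hα : α < Module.finrank ℝ E) (r : ℝ) :
    ∫⁻ w in Metric.ball (0 : E) r, ‖w‖ₑ ^ (-α) ∂μ < ⊤ := by
  have : Nontrivial E := Module.nontrivial_of_finrank_pos (R := ℝ) (by lia)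
  have hint : IntegrableOn (fun w : E => ‖w‖ ^ (-α)) (Metric.ball 0 r) μ := by
    refine integrableOn_ball_of_norm_le_rpow hd (C := 1) hα (ae_of_all _ fun w => ?_) ?_
    · rw [one_mul, Real.norm_of_nonneg (by positivity)]
    · exact (measurable_norm.pow_const (-α)).aestronglyMeasurable
  have h0 : ∀ᵐ w ∂μ.restrict (Metric.ball 0 r), w ≠ 0 :=
    ae_restrict_of_ae (compl_mem_ae_iff.2 (measure_singleton (0 : E)))
  refine lt_of_eq_of_lt (lintegral_congr_ae ?_) hint.2
  filter_upwards [h0] with w hw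
  have hw' : 0 < ‖w‖ := norm_pos_iff.2 hw
  rw [Real.enorm_eq_ofReal (by positivity), ← ENNReal.ofReal_rpow_of_pos hw', ofReal_norm]

/-- Powers of a single coordinate with exponent above `-1` are integrable on balls. -/
theorem lintegral_ball_enorm_coord_rpow_neg_lt_top {n : ℕ} (i : Fin n) {α : ℝ} (hα : α < 1)
    (r : ℝ) :
    ∫⁻ w in Metric.ball (0 : EuclideanSpace ℝ (Fin n)) r, ‖w i‖ₑ ^ (-α) < ⊤ := by
  have hmeas : Measurable fun t : ℝ => ‖t‖ₑ ^ (-α) := by fun_prop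
  have hsub : Metric.ball (0 : EuclideanSpace ℝ (Fin n)) r ⊆
      WithLp.ofLp ⁻¹' (univ.pi fun _ => Metric.ball (0 : ℝ) r) := by
    intro w hw j _
    rw [mem_ball_zero_iff] at hw ⊢
    exact (PiLp.norm_apply_le w j).trans_lt hw
  have hbox : MeasurableSet (univ.pi fun _ : Fin n => Metric.ball (0 : ℝ) r) :=
    MeasurableSet.univ_pi fun _ => measurableSet_ball
  have hcoord : Measurable fun w : Fin n → ℝ => ‖w i‖ₑ ^ (-α) :=
    hmeas.comp (measurable_pi_apply i)
  refine (lintegral_mono_set hsub).trans_lt ?_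
  rw [(PiLp.volume_preserving_ofLp (Fin n)).setLIntegral_comp_preimage hbox hcoord, volume_pi,
    Measure.restrict_pi_pi]
  refine (lintegral_map (μ := Measure.pi fun _ : Fin n => volume.restrict (Metric.ball (0 : ℝ) r))
    (g := Function.eval i) hmeas (measurable_pi_apply i)).symm.trans_lt ?_
  rw [Measure.pi_map_eval, lintegral_smul_measure, smul_eq_mul]
  refine ENNReal.mul_lt_top (ENNReal.prod_lt_top fun j _ => ?_) ?_
  · simpa using measure_ball_lt_top (μ := volume) (x := (0 : ℝ)) (r := r)
  · exact lintegral_ball_enorm_rpow_neg_lt_top volume (by simp) (by simpa using hα) r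

/-- The integral over a centred ball of a function of one coordinate does not depend on the
orthonormal basis. -/
theorem lintegral_ball_enorm_inner_basis {n : ℕ}
    (b : OrthonormalBasis (Fin n) ℝ (EuclideanSpace ℝ (Fin n))) (i : Fin n) (α r : ℝ) :
    ∫⁻ w in Metric.ball (0 : EuclideanSpace ℝ (Fin n)) r, ‖⟪b i, w⟫‖ₑ ^ (-α) =
      ∫⁻ w in Metric.ball (0 : EuclideanSpace ℝ (Fin n)) r, ‖w i‖ₑ ^ (-α) := by
  have hm : Measurable fun w : EuclideanSpace ℝ (Fin n) => ‖w i‖ₑ ^ (-α) := by fun_prop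
  rw [← b.measurePreserving_repr.setLIntegral_comp_preimage measurableSet_ball hm,
    LinearIsometryEquiv.preimage_ball, map_zero]
  simp_rw [OrthonormalBasis.repr_apply_apply]

/-- A translated nonnegative integral over `X` is dominated by that over a centred ball. -/
theorem setLIntegral_sub_le_ball {E : Type*} [NormedAddCommGroup E] [MeasurableSpace E]
    [BorelSpace E] (μ : Measure E) [μ.IsAddRightInvariant] {X : Set E} {y : E} {r : ℝ}
    (hX : ∀ z ∈ X, dist z y < r) (f : E → ENNReal) :
    ∫⁻ z in X, f (z - y) ∂μ ≤ ∫⁻ w in Metric.ball (0 : E) r, f w ∂μ := by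
  have hsub : X ⊆ (fun z => z - y) ⁻¹' Metric.ball 0 r := by
    intro z hz
    simpa [← dist_eq_norm] using hX z hz
  refine (lintegral_mono_set hsub).trans_eq ?_
  exact (measurePreserving_sub_right μ y).setLIntegral_comp_preimage_emb
    (MeasurableEquiv.subRight y).measurableEmbedding _ _

/-- On `(0, M]` the logarithm is bounded by a negative power, up to a constant. -/
theorem abs_log_le_mul_rpow_neg {ε M t : ℝ} (hε : 0 < ε) (ht : 0 < t) (htM : t ≤ M) :
    |Real.log t| ≤ (1 / ε + M ^ (1 + ε)) * t ^ (-ε) := by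
  have hM : 0 < M := ht.trans_le htM
  have hpos : 0 < t ^ (-ε) := Real.rpow_pos_of_pos ht _
  rcases le_total t 1 with h1 | h1
  · have h := (Real.abs_log_mul_self_rpow_lt t ε ht h1 hε).le
    rw [abs_mul, abs_of_pos (Real.rpow_pos_of_pos ht ε)] at h
    calc |Real.log t| = |Real.log t| * t ^ ε * t ^ (-ε) := by
          rw [mul_assoc, ← Real.rpow_add ht]; simp
      _ ≤ (1 / ε + M ^ (1 + ε)) * t ^ (-ε) := by
          gcongr
          exact h.trans (le_add_of_nonneg_right (by positivity))
  · calc |Real.log t| = Real.log t := abs_of_nonneg (Real.log_nonneg h1)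
      _ ≤ t := Real.log_le_self ht.le
      _ = t ^ (1 + ε) * t ^ (-ε) := by rw [← Real.rpow_add ht]; simp
      _ ≤ (1 / ε + M ^ (1 + ε)) * t ^ (-ε) := by
          gcongr
          exact (Real.rpow_le_rpow ht.le htM (by positivity)).trans
            (le_add_of_nonneg_left (by positivity))

/-- If `|c| ≤ t ≤ M` then `|log t|` is bounded by a negative power of `|c|`. -/
theorem ofReal_abs_log_le_enorm_rpow_neg {ε M t c : ℝ} (hε : 0 < ε) (hc : |c| ≤ t) (htM : t ≤ M) :
    ENNReal.ofReal |Real.log t| ≤ ENNReal.ofReal (1 / ε + M ^ (1 + ε)) * ‖c‖ₑ ^ (-ε) := by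
  have ht0 : 0 ≤ t := (abs_nonneg c).trans hc
  rcases ht0.eq_or_lt with rfl | ht
  · simp
  have hM : 0 < M := ht.trans_le htM
  calc ENNReal.ofReal |Real.log t|
      ≤ ENNReal.ofReal ((1 / ε + M ^ (1 + ε)) * t ^ (-ε)) :=
        ENNReal.ofReal_le_ofReal (abs_log_le_mul_rpow_neg hε ht htM)
    _ = ENNReal.ofReal (1 / ε + M ^ (1 + ε)) * ENNReal.ofReal t ^ (-ε) := by
        rw [ENNReal.ofReal_mul (by positivity), ENNReal.ofReal_rpow_of_pos ht]
    _ ≤ ENNReal.ofReal (1 / ε + M ^ (1 + ε)) * ‖c‖ₑ ^ (-ε) := by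
        refine mul_le_mul_right ?_ _
        rw [ENNReal.rpow_neg, ENNReal.rpow_neg, ENNReal.inv_le_inv]
        refine ENNReal.rpow_le_rpow ?_ hε.le
        rw [← ofReal_norm, Real.norm_eq_abs]
        exact ENNReal.ofReal_le_ofReal hc

/-- Young's inequality with the weights dropped. -/
theorem ENNReal.mul_le_rpow_add_rpow (a b : ENNReal) {p q : ℝ} (hpq : p.HolderConjugate q) :
    a * b ≤ a ^ p + b ^ q := by
  refine (ENNReal.young_inequality a b hpq).trans (add_le_add ?_ ?_)
  · exact ENNReal.div_le_of_le_mul (le_mul_of_one_le_right' (by simpa using hpq.lt.le))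
  · exact ENNReal.div_le_of_le_mul (le_mul_of_one_le_right' (by simpa using hpq.symm.lt.le))

/-- The component of `w` orthogonal to the basis vector `b i` dominates every other coordinate. -/
theorem OrthonormalBasis.abs_inner_le_norm_sub_proj {ι E : Type*} [Fintype ι]
    [NormedAddCommGroup E] [InnerProductSpace ℝ E] (b : OrthonormalBasis ι ℝ E) {i j : ι}
    (hij : i ≠ j) (w : E) : |⟪b j, w⟫| ≤ ‖w - ⟪w, b i⟫ • b i‖ := by
  have h : ⟪b j, w - ⟪w, b i⟫ • b i⟫ = ⟪b j, w⟫ := by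
    rw [inner_sub_right, inner_smul_right, b.orthonormal.inner_eq_zero hij.symm, mul_zero, sub_zero]
  calc |⟪b j, w⟫| = |⟪b j, w - ⟪w, b i⟫ • b i⟫| := by rw [h]
    _ ≤ ‖b j‖ * ‖w - ⟪w, b i⟫ • b i‖ := abs_real_inner_le_norm _ _
    _ = ‖w - ⟪w, b i⟫ • b i‖ := by rw [b.norm_eq_one, one_mul]

/-- Every unit vector belongs to an orthonormal basis, at a prescribed index. -/
theorem exists_orthonormalBasis_apply_eq {n : ℕ} (i : Fin n) {v : EuclideanSpace ℝ (Fin n)}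
    (hv : ‖v‖ = 1) :
    ∃ b : OrthonormalBasis (Fin n) ℝ (EuclideanSpace ℝ (Fin n)), b i = v := by
  have hon : Orthonormal ℝ (({i} : Set (Fin n)).domRestrict fun _ => v) :=
    ⟨fun _ => hv, fun j k hjk => (hjk (Subsingleton.elim j k)).elim⟩
  obtain ⟨b, hb⟩ := hon.exists_orthonormalBasis_extension_of_card_eq (by simp)
  exact ⟨b, hb i rfl⟩

/-- For `n ≥ 3` and a bounded open `X ⊂ ℝⁿ`, there is a constant `C` such that for every
`x ∈ X`, `x' ∈ closure X` and unit vector `v'`,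
`∫_X |ln|(z−x')_⊥||/|x−z|^{n−1} dz ≤ C`, where `(z−x')_⊥ = (z−x') − ((z−x')·v')v'`. -/
theorem singular_integral_log_perp_bound {n : ℕ} (hn : 3 ≤ n)
    (X : Set (EuclideanSpace ℝ (Fin n))) (hXo : IsOpen X) (hXb : Bornology.IsBounded X) :
    ∃ C : ℝ, ∀ x ∈ X, ∀ x' ∈ closure X, ∀ v' : EuclideanSpace ℝ (Fin n), ‖v'‖ = 1 →
      ∫⁻ z in X,
          ENNReal.ofReal
            (|Real.log ‖(z - x') - ⟪z - x', v'⟫ • v'‖| / ‖x - z‖ ^ (n-1)) ≤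
        ENNReal.ofReal C := by
  have hn' : (3 : ℝ) ≤ n := by exact_mod_cast hn
  let i₀ : Fin n := ⟨0, by lia⟩
  let i₁ : Fin n := ⟨1, by lia⟩
  have hi : i₀ ≠ i₁ := by simp [i₀, i₁]
  set R : ℝ := Metric.diam X + 1
  set q : ℝ := 2 * n - 1 with hq
  set p : ℝ := q / (q - 1) with hp
  have hqp : q.HolderConjugate p := Real.HolderConjugate.conjExponent (by linarith)
  set ε : ℝ := 1 / (2 * q) with hε
  have hq0 : 0 < q := by linarith
  have hε0 : 0 < ε := by positivity
  set K : ENNReal := ENNReal.ofReal (1 / ε + (2 * R) ^ (1 + ε))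
  set I₁ := ∫⁻ w in Metric.ball (0 : EuclideanSpace ℝ (Fin n)) R, ‖w i₁‖ₑ ^ (-(1 / 2) : ℝ) with hI₁
  set I₂ := ∫⁻ w in Metric.ball (0 : EuclideanSpace ℝ (Fin n)) R, ‖w‖ₑ ^ (-(n - 1 / 2) : ℝ)
  have hI₁_top : I₁ < ⊤ := lintegral_ball_enorm_coord_rpow_neg_lt_top i₁ (by norm_num) R
  have hI₂_top : I₂ < ⊤ :=
    lintegral_ball_enorm_rpow_neg_lt_top volume (by simp; lia) (by simp) R
  have hK_top : K ^ q < ⊤ := ENNReal.rpow_lt_top_of_nonneg hq0.le ENNReal.ofReal_ne_top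
  have htop : K ^ q * I₁ + I₂ ≠ ⊤ := by finiteness
  refine ⟨(K ^ q * I₁ + I₂).toReal, fun x hx x' hx' v' hv' => ?_⟩
  rw [ENNReal.ofReal_toReal htop]
  obtain ⟨b, rfl⟩ := exists_orthonormalBasis_apply_eq i₀ hv'
  have hdist : ∀ y ∈ closure X, ∀ z ∈ X, dist z y < R := fun y hy z hz => by
    have h := Metric.dist_le_diam_of_mem hXb.closure (subset_closure hz) hy
    rw [Metric.diam_closure] at h
    linarith
  have hpt : ∀ z ∈ X, ENNReal.ofReal
      (|Real.log ‖(z - x') - ⟪z - x', b i₀⟫ • b i₀‖| / ‖x - z‖ ^ (n - 1)) ≤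
      K ^ q * ‖⟪b i₁, z - x'⟫‖ₑ ^ (-(1 / 2) : ℝ) + ‖z - x‖ₑ ^ (-(n - 1 / 2) : ℝ) := by
    intro z hz
    have hw : ‖z - x'‖ ≤ R := by
      rw [← dist_eq_norm]; exact (hdist x' hx' z hz).le
    have hperp : ‖(z - x') - ⟪z - x', b i₀⟫ • b i₀‖ ≤ 2 * R := by
      have h₁ := abs_real_inner_le_norm (z - x') (b i₀)
      have h₂ := norm_sub_le (z - x') (⟪z - x', b i₀⟫ • b i₀)
      rw [norm_smul, Real.norm_eq_abs, b.norm_eq_one] at h₂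
      rw [b.norm_eq_one] at h₁
      linarith
    have hlog := ofReal_abs_log_le_enorm_rpow_neg hε0
      (b.abs_inner_le_norm_sub_proj hi (z - x')) hperp
    have hker : ENNReal.ofReal (‖x - z‖ ^ (n - 1))⁻¹ ≤ ‖z - x‖ₑ ^ (-(n - 1) : ℝ) := by
      rcases eq_or_ne z x with rfl | hne
      · simp [show n - 1 ≠ 0 by lia]
      · have hpos : 0 < ‖z - x‖ := norm_pos_iff.2 (sub_ne_zero.2 hne)
        rw [norm_sub_rev, ← ofReal_norm, ENNReal.ofReal_rpow_of_pos hpos, Real.rpow_neg hpos.le,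
          ← Nat.cast_pred (by lia), Real.rpow_natCast]
    rw [div_eq_mul_inv, ENNReal.ofReal_mul (abs_nonneg _)]
    refine (mul_le_mul' hlog hker).trans ((ENNReal.mul_le_rpow_add_rpow _ _ hqp).trans_eq ?_)
    rw [ENNReal.mul_rpow_of_nonneg _ _ hq0.le, ← ENNReal.rpow_mul, ← ENNReal.rpow_mul]
    have e₁ : -ε * q = -(1 / 2) := by rw [hε]; field_simp
    have e₂ : -((n : ℝ) - 1) * p = -(n - 1 / 2) := by
      have : (n : ℝ) - 1 ≠ 0 := by linarith
      have : q - 1 = 2 * (n - 1) := by rw [hq]; ring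
      rw [hp, this, hq]; field_simp
    rw [e₁, e₂]
  have hm : Measurable fun z : EuclideanSpace ℝ (Fin n) =>
      K ^ q * ‖⟪b i₁, z - x'⟫‖ₑ ^ (-(1 / 2) : ℝ) := by fun_prop
  refine (setLIntegral_mono' hXo.measurableSet hpt).trans ?_
  rw [lintegral_add_left hm, lintegral_const_mul' _ _ hK_top.ne]
  gcongr
  · rw [hI₁, ← lintegral_ball_enorm_inner_basis b]
    exact setLIntegral_sub_le_ball volume (hdist x' hx')
      (fun w => ‖⟪b i₁, w⟫‖ₑ ^ (-(1 / 2) : ℝ))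
  · exact setLIntegral_sub_le_ball volume (hdist x (subset_closure hx))
      (fun w => ‖w‖ₑ ^ (-(n - 1 / 2) : ℝ))
end

section
/- Let n ≥ 2 be an integer and let X be a bounded open subset of ℝⁿ. Then sup over (z₀, z_{n+1}) ∈ X × X of the iterated integral ∫_{Xⁿ} ∏_{i=1}^{n+1} |z_i − z_{i−1}|^{−(n−1)} dz₁ ⋯ dzₙ is finite; that is, there exists a constant C such that for all z₀, z_{n+1} ∈ X, ∫_{Xⁿ} dz₁ ⋯ dzₙ / ( |z₁−z₀|^{n−1} |z₂−z₁|^{n−1} ⋯ |z_{n+1}−z_n|^{n−1} ) ≤ C. -/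
open MeasureTheory Real Set

/-- The chain of points `z₀, z₁, …, zₙ, z_{n+1}`: position `0` is `z₀`, positions
`1, …, n` are the integration variables, and position `n+1` is `z_{n+1}`. -/
noncomputable def chainPts {n : ℕ} (z₀ zLast : EuclideanSpace ℝ (Fin n))
    (z : Fin n → EuclideanSpace ℝ (Fin n)) : Fin (n+2) → EuclideanSpace ℝ (Fin n) :=
  Fin.cons z₀ (Fin.snoc z zLast)

open scoped ENNReal

theorem lintegral_pi_le_lintegral_insertNth {α : Type*} [MeasurableSpace α] (μ : Measure α)
    [SigmaFinite μ] {m : ℕ} (i : Fin (m + 1)) (F : (Fin (m + 1) → α) → ℝ≥0∞) :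
    ∫⁻ z, F z ∂Measure.pi (fun _ => μ) ≤
      ∫⁻ x, ∫⁻ z, F (i.insertNth (α := fun _ => α) x z) ∂Measure.pi (fun _ => μ) ∂μ := by
  have h := (measurePreserving_piFinSuccAbove (fun _ : Fin (m + 1) => μ) i).symm
  rw [← h.lintegral_comp_emb (MeasurableEquiv.measurableEmbedding _)]
  exact lintegral_prod_le _

/-- If the kernel `k` has integrals at most `K` in each variable, then a chain of kernels with
one edge `j` deleted has integral at most `K ^ m`, uniformly in the endpoints. -/
theorem lintegral_chain_succAbove_le {α : Type*} [MeasurableSpace α] (μ : Measure α)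
    [SigmaFinite μ] {k : α → α → ℝ≥0∞} {K : ℝ≥0∞} (hK : K ≠ ∞) (hk : ∀ x y, k x y ≠ ∞)
    (hl : ∀ x, ∫⁻ y, k x y ∂μ ≤ K) (hr : ∀ y, ∫⁻ x, k x y ∂μ ≤ K) (m : ℕ) (j : Fin (m + 1))
    (a b : α) :
    ∫⁻ z, ∏ i : Fin m,
      k (Fin.cons (α := fun _ => α) a (Fin.snoc (α := fun _ => α) z b) (j.succAbove i).castSucc)
        (Fin.cons (α := fun _ => α) a (Fin.snoc (α := fun _ => α) z b) (j.succAbove i).succ)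
      ∂Measure.pi (fun _ => μ) ≤ K ^ m := by
  induction m generalizing a b with
  | zero => simp
  | succ m ih =>
    induction j using Fin.cases with
    | zero =>
      refine (lintegral_pi_le_lintegral_insertNth μ (Fin.last m) _).trans ?_
      calc
        _ ≤ ∫⁻ x, K ^ m * k x b ∂μ := by
          refine lintegral_mono fun x => ?_
          refine le_trans (le_of_eq ?_) (mul_le_mul_left (ih 0 a x) (k x b))
          rw [← lintegral_mul_const' _ _ (hk x b)]
          refine lintegral_congr fun z => ?_
          simp [Fin.prod_univ_castSucc, Fin.cons_snoc_eq_snoc_cons, ← Fin.castSucc_succ]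
        _ ≤ K ^ (m + 1) := by
          rw [lintegral_const_mul' _ _ (ENNReal.pow_ne_top hK), pow_succ]
          gcongr
          exact hr b
    | succ j =>
      refine (lintegral_pi_le_lintegral_insertNth μ 0 _).trans ?_
      calc
        _ ≤ ∫⁻ x, k a x * K ^ m ∂μ := by
          refine lintegral_mono fun x => ?_
          refine le_trans (le_of_eq ?_) (mul_le_mul_right (ih j x b) (k a x))
          rw [← lintegral_const_mul' _ _ (hk a x)]
          refine lintegral_congr fun z => ?_
          simp [Fin.prod_univ_succ, ← Fin.cons_snoc_eq_snoc_cons]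
        _ ≤ K ^ (m + 1) := by
          rw [lintegral_mul_const' _ _ (ENNReal.pow_ne_top hK), pow_succ']
          gcongr
          exact hl a

/-- The product of `m + 1` numbers is at most the sum over `j` of the products of the
`(m + 1) / m`-th powers of the numbers other than the `j`-th. -/
theorem prod_le_sum_prod_succAbove_rpow {m : ℕ} (hm : m ≠ 0) (a : Fin (m + 1) → ℝ≥0∞) :
    ∏ i, a i ≤ ∑ j : Fin (m + 1), ∏ i, a (j.succAbove i) ^ ((m : ℝ)⁻¹ + 1) := by
  obtain ⟨j, hj⟩ := Finite.exists_min a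
  calc
    ∏ i, a i = (∏ _i : Fin m, a j ^ (m : ℝ)⁻¹) * ∏ i, a (j.succAbove i) := by
      rw [Fin.prod_univ_succAbove _ j, Finset.prod_const, Finset.card_univ, Fintype.card_fin,
        ← ENNReal.rpow_mul_natCast, inv_mul_cancel₀ (by exact_mod_cast hm), ENNReal.rpow_one]
    _ ≤ ∏ i, a (j.succAbove i) ^ ((m : ℝ)⁻¹ + 1) := by
      rw [← Finset.prod_mul_distrib]
      refine Finset.prod_le_prod' fun i _ => ?_
      rw [ENNReal.rpow_add_of_nonneg _ _ (by positivity) zero_le_one, ENNReal.rpow_one]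
      gcongr
      exact hj _
    _ ≤ _ := Finset.single_le_sum (f := fun j => ∏ i, a (j.succAbove i) ^ ((m : ℝ)⁻¹ + 1))
      (fun _ _ => zero_le) (Finset.mem_univ j)

/-- A singularity `‖x - y‖ ^ (-s)` of order `s` below the dimension is integrable in `y` over bounded
sets, uniformly in `x`. -/
theorem exists_setLIntegral_norm_sub_rpow_le {E : Type*} [NormedAddCommGroup E]
    [NormedSpace ℝ E] [FiniteDimensional ℝ E] [MeasurableSpace E] [BorelSpace E]
    (μ : Measure E) [μ.IsAddHaarMeasure] (hd : 1 ≤ Module.finrank ℝ E) {s : ℝ} (hs : 0 ≤ s)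
    (hsd : s < Module.finrank ℝ E) {X : Set E} (hX : Bornology.IsBounded X) :
    ∃ K : ℝ≥0∞, K ≠ ∞ ∧ ∀ x, ∫⁻ y in X, ENNReal.ofReal (‖x - y‖ ^ (-s)) ∂μ ≤ K := by
  have hint : IntegrableOn (fun x : E => ‖x‖ ^ (-s)) (Metric.ball 0 1) μ := by
    refine integrableOn_ball_of_norm_le_rpow (C := 1) (α := s) hd hsd
      (ae_of_all _ fun x => ?_)
      (measurable_norm.pow_const _).aestronglyMeasurable
    rw [Real.norm_of_nonneg (by positivity), one_mul]
  set g : E → ℝ≥0∞ := (Metric.ball 0 1).indicator fun x => ENNReal.ofReal (‖x‖ ^ (-s))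
  refine ⟨∫⁻ x, g x ∂μ + μ X, ENNReal.add_ne_top.2 ⟨?_, hX.measure_lt_top.ne⟩, fun x => ?_⟩
  · rw [lintegral_indicator Metric.isOpen_ball.measurableSet]
    exact hint.lintegral_lt_top.ne
  · calc
      _ ≤ ∫⁻ y in X, (g (x - y) + 1) ∂μ := by
        refine lintegral_mono fun y => ?_
        by_cases h : x - y ∈ Metric.ball 0 1
        · simp [g, indicator_of_mem h]
        · simp only [Metric.mem_ball, dist_zero_right, not_lt] at h
          refine le_trans ?_ le_add_self
          exact ENNReal.ofReal_le_one.2 (Real.rpow_le_one_of_one_le_of_nonpos h (by linarith))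
      _ = ∫⁻ y in X, g (x - y) ∂μ + μ X := by
        rw [lintegral_add_right _ measurable_const, setLIntegral_one]
      _ ≤ ∫⁻ y, g (x - y) ∂μ + μ X := by
        gcongr
        exact Measure.restrict_le_self
      _ = _ := by rw [lintegral_sub_left_eq_self]

/-- For `n ≥ 2` and a bounded open `X ⊂ ℝⁿ`, the iterated integral
`∫_{Xⁿ} ∏_{i=1}^{n+1} |z_i − z_{i−1}|^{−(n−1)} dz₁⋯dzₙ` is bounded uniformly in
`(z₀, z_{n+1}) ∈ X × X`. -/
theorem iterated_singular_integral_bounded {n : ℕ} (hn : 2 ≤ n)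
    (X : Set (EuclideanSpace ℝ (Fin n))) (hXo : IsOpen X) (hXb : Bornology.IsBounded X) :
    ∃ C : ℝ, ∀ z₀ ∈ X, ∀ zLast ∈ X,
      ∫⁻ z in Set.univ.pi (fun _ : Fin n => X),
          ∏ i : Fin (n+1),
            ENNReal.ofReal
              (1 / ‖chainPts z₀ zLast z i.succ - chainPts z₀ zLast z i.castSucc‖ ^ (n-1)) ≤
        ENNReal.ofReal C := by
  have hn' : (2 : ℝ) ≤ n := by exact_mod_cast hn
  set p : ℝ := (n : ℝ)⁻¹ + 1 with hp
  have hp0 : 0 < p := by positivity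
  set s : ℝ := (n - 1) * p with hs
  have hs0 : 0 ≤ s := mul_nonneg (by linarith) hp0.le
  have hsn : s < n := by
    have : s = n - (n : ℝ)⁻¹ := by rw [hs, hp]; field_simp; ring
    rw [this]
    exact sub_lt_self _ (by positivity)
  obtain ⟨K, hK, hKx⟩ := exists_setLIntegral_norm_sub_rpow_le
    (volume : Measure (EuclideanSpace ℝ (Fin n))) (by simp; lia) hs0 (by simpa using hsn) hXb
  let k : EuclideanSpace ℝ (Fin n) → EuclideanSpace ℝ (Fin n) → ℝ≥0∞ :=
    fun x y => ENNReal.ofReal (‖x - y‖ ^ (-s))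
  have hedge (x y : EuclideanSpace ℝ (Fin n)) :
      ENNReal.ofReal (1 / ‖y - x‖ ^ (n - 1)) ^ p = k x y := by
    rw [ENNReal.ofReal_rpow_of_nonneg (by positivity) hp0.le, norm_sub_rev, one_div,
      ← Real.rpow_natCast, ← Real.rpow_neg (norm_nonneg _), ← Real.rpow_mul (norm_nonneg _),
      Nat.cast_sub (by lia), Nat.cast_one, neg_mul]
  have hmeas (z₀ zLast : EuclideanSpace ℝ (Fin n)) (i : Fin (n + 2)) :
      Measurable fun z => chainPts z₀ zLast z i := by
    unfold chainPts
    induction i using Fin.cases with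
    | zero => simp
    | succ i =>
      induction i using Fin.lastCases with
      | last => simp
      | cast i => simpa using measurable_pi_apply i
  refine ⟨((n + 1 : ℕ) * K ^ n).toReal, fun z₀ _ zLast _ => ?_⟩
  rw [ENNReal.ofReal_toReal (ENNReal.mul_ne_top (by simp) (ENNReal.pow_ne_top hK)), volume_pi,
    Measure.restrict_pi_pi]
  calc
    _ ≤ ∫⁻ z, ∑ j : Fin (n + 1), ∏ i : Fin n,
          k (chainPts z₀ zLast z (j.succAbove i).castSucc)
            (chainPts z₀ zLast z (j.succAbove i).succ)
          ∂Measure.pi fun _ => volume.restrict X := by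
      refine lintegral_mono fun z => ?_
      refine (prod_le_sum_prod_succAbove_rpow (by lia) _).trans (le_of_eq ?_)
      simp_rw [← hp, hedge]
    _ = ∑ j : Fin (n + 1), ∫⁻ z, ∏ i : Fin n,
          k (chainPts z₀ zLast z (j.succAbove i).castSucc)
            (chainPts z₀ zLast z (j.succAbove i).succ)
          ∂Measure.pi fun _ => volume.restrict X := by
      refine lintegral_finsetSum _ fun j _ => Finset.measurable_prod _ fun i _ => ?_
      exact ((((hmeas _ _ _).sub (hmeas _ _ _)).norm).pow_const _).ennreal_ofReal
    _ ≤ ∑ _j : Fin (n + 1), K ^ n := by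
      refine Finset.sum_le_sum fun j _ => ?_
      refine lintegral_chain_succAbove_le _ hK (fun _ _ => ENNReal.ofReal_ne_top) hKx
        (fun y => ?_) n j z₀ zLast
      simpa only [k, norm_sub_rev] using hKx y
    _ = _ := by simp
end

section
/- Let n = 2 and X ⊂ ℝ² a nonempty bounded convex open set. Let σ : ℝ²×S¹ → ℝ and k : ℝ²×S¹×S¹ → ℝ be bounded continuous functions, and set σ_a(x,v) := σ(x,v) − ∫_{S¹} k(x,v,v¹) dv¹. For distinct x₀, x₁ ∈ ℝ² define E(x₀,x₁) := exp( −∫₀^{|x₀−x₁|} σ( x₀ − s u, u ) ds ) with u = (x₀−x₁)/|x₀−x₁|, E(y,y) := 1, and E(x₀,x₁,x₂) := E(x₀,x₁)E(x₁,x₂). Let x' ∈ closure(X) and v' ∈ S¹ be such that x' + s v' ∈ X for some s > 0, set τ := sup{ s > 0 : x' + s v' ∈ X }, let t₀ ∈ (0,τ), x := x' + t₀ v', and let w ∈ S¹ with w·v' = 0. For ε > 0 define L(ε) := ∫₀^{τ} E( x + ε w, x' + t' v', x' ) σ_a( x + ε w, v_{t',ε} ) k( x' + t' v', v', v_{t',ε}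 ) ( (t'−t₀)² + ε² )^{−1/2} dt', where v_{t',ε} := ( (t₀−t') v' + ε w ) / √( (t₀−t')² + ε² ). Then L(ε) / ln(1/ε) → E(x,x') ( σ_a(x,v') k(x,v',v') + σ_a(x,−v') k(x,v',−v') ) as ε → 0⁺. -/
open MeasureTheory Real Set RealInnerProductSpace

/-- The attenuation factor `E(x₀,x₁) = exp(−∫₀^{|x₀−x₁|} σ(x₀ − s u, u) ds)` with
`u = (x₀−x₁)/|x₀−x₁|`; for `x₀ = x₁` the integral is empty so the value is `1`. -/
noncomputable def attenuation
    (σ : EuclideanSpace ℝ (Fin 2) → EuclideanSpace ℝ (Fin 2) → ℝ)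
    (x₀ x₁ : EuclideanSpace ℝ (Fin 2)) : ℝ :=
  Real.exp (-(∫ s in (0:ℝ)..‖x₀ - x₁‖,
    σ (x₀ - s • (‖x₀ - x₁‖⁻¹ • (x₀ - x₁))) (‖x₀ - x₁‖⁻¹ • (x₀ - x₁))))

/-- The intrinsic attenuation `σ_a(x,v) = σ(x,v) − ∫_{S¹} k(x,v,v¹) dv¹`, the circle
carrying its canonical arclength measure. -/
noncomputable def sigmaA
    (σ : EuclideanSpace ℝ (Fin 2) → EuclideanSpace ℝ (Fin 2) → ℝ)
    (k : EuclideanSpace ℝ (Fin 2) → EuclideanSpace ℝ (Fin 2) →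
      EuclideanSpace ℝ (Fin 2) → ℝ)
    (x v : EuclideanSpace ℝ (Fin 2)) : ℝ :=
  σ x v - ∫ u : Metric.sphere (0 : EuclideanSpace ℝ (Fin 2)) 1,
    k x v (u : EuclideanSpace ℝ (Fin 2)) ∂((volume : Measure (EuclideanSpace ℝ (Fin 2))).toSphere)

/-- In terms of the direction `d = x₀ - x₁`, the attenuation is an integral over `[0, 1]`. -/
theorem attenuation_eq_exp_unitInterval
    (σ : EuclideanSpace ℝ (Fin 2) → EuclideanSpace ℝ (Fin 2) → ℝ)
    (x₀ x₁ : EuclideanSpace ℝ (Fin 2)) (h : x₀ ≠ x₁) :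
    attenuation σ x₀ x₁ = Real.exp (-(‖x₀ - x₁‖ * ∫ r in (0:ℝ)..1,
      σ (x₀ - r • (x₀ - x₁)) (‖x₀ - x₁‖⁻¹ • (x₀ - x₁)))) := by
  have hne : ‖x₀ - x₁‖ ≠ 0 := norm_ne_zero_iff.mpr (sub_ne_zero.mpr h)
  have key := intervalIntegral.mul_integral_comp_mul_left (a := 0) (b := 1)
    (f := fun s => σ (x₀ - s • (‖x₀ - x₁‖⁻¹ • (x₀ - x₁))) (‖x₀ - x₁‖⁻¹ • (x₀ - x₁))) ‖x₀ - x₁‖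
  rw [mul_zero, mul_one] at key
  rw [attenuation, ← key]
  congr 5
  ext r
  congr 2
  rw [smul_smul]
  congr 1
  field_simp

theorem attenuation_self (σ : EuclideanSpace ℝ (Fin 2) → EuclideanSpace ℝ (Fin 2) → ℝ)
    (x : EuclideanSpace ℝ (Fin 2)) : attenuation σ x x = 1 := by
  simp [attenuation]

theorem inv_norm_smul_mem_unitSphere {V : Type*} [NormedAddCommGroup V] [NormedSpace ℝ V]
    {d : V} (hd : d ≠ 0) : ‖d‖⁻¹ • d ∈ Metric.sphere (0 : V) 1 := by
  rw [mem_sphere_zero_iff_norm, norm_smul, norm_inv, norm_norm,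
    inv_mul_cancel₀ (norm_ne_zero_iff.mpr hd)]

theorem continuous_attenuation
    {σ : EuclideanSpace ℝ (Fin 2) → EuclideanSpace ℝ (Fin 2) → ℝ}
    (hσc : ContinuousOn (fun p : EuclideanSpace ℝ (Fin 2) × EuclideanSpace ℝ (Fin 2) =>
      σ p.1 p.2) (Set.univ ×ˢ Metric.sphere 0 1))
    {M : ℝ} (hM : ∀ x v : EuclideanSpace ℝ (Fin 2),
      v ∈ Metric.sphere (0 : EuclideanSpace ℝ (Fin 2)) 1 → |σ x v| ≤ M) :
    Continuous (fun p : EuclideanSpace ℝ (Fin 2) × EuclideanSpace ℝ (Fin 2) =>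
      attenuation σ p.1 p.2) := by
  rw [continuous_iff_continuousAt]
  rintro ⟨a, b⟩
  by_cases hab : a = b
  · subst hab
    refine Real.continuous_exp.continuousAt.comp (ContinuousAt.neg ?_)
    have hbound : ∀ p : EuclideanSpace ℝ (Fin 2) × EuclideanSpace ℝ (Fin 2),
        ‖∫ s in (0:ℝ)..‖p.1 - p.2‖, σ (p.1 - s • (‖p.1 - p.2‖⁻¹ • (p.1 - p.2)))
          (‖p.1 - p.2‖⁻¹ • (p.1 - p.2))‖ ≤ M * ‖p.1 - p.2‖ := by
      intro p
      rcases eq_or_ne p.1 p.2 with h | h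
      · simp [h]
      · have := intervalIntegral.norm_integral_le_of_norm_le_const (a := 0) (b := ‖p.1 - p.2‖)
          (C := M) (f := fun s => σ (p.1 - s • (‖p.1 - p.2‖⁻¹ • (p.1 - p.2)))
            (‖p.1 - p.2‖⁻¹ • (p.1 - p.2)))
          (fun s _ => hM _ _ (inv_norm_smul_mem_unitSphere (sub_ne_zero.mpr h)))
        simpa using this
    have hlim : Filter.Tendsto
        (fun p : EuclideanSpace ℝ (Fin 2) × EuclideanSpace ℝ (Fin 2) => M * ‖p.1 - p.2‖)
        (nhds (a, a)) (nhds 0) := by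
      have : Continuous
          (fun p : EuclideanSpace ℝ (Fin 2) × EuclideanSpace ℝ (Fin 2) => M * ‖p.1 - p.2‖) := by
        fun_prop
      simpa using this.tendsto (a, a)
    simpa [ContinuousAt] using squeeze_zero_norm hbound hlim
  · have hopen : ∀ᶠ p : EuclideanSpace ℝ (Fin 2) × EuclideanSpace ℝ (Fin 2) in nhds (a, b),
        p.1 ≠ p.2 := by
      have hopen : IsOpen {p : EuclideanSpace ℝ (Fin 2) × EuclideanSpace ℝ (Fin 2) |
        p.1 ≠ p.2} := isOpen_ne_fun continuous_fst continuous_snd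
      exact hopen.eventually_mem (x := (a, b)) hab
    have hdir : ContinuousAt (fun p : EuclideanSpace ℝ (Fin 2) × EuclideanSpace ℝ (Fin 2) =>
        ‖p.1 - p.2‖⁻¹ • (p.1 - p.2)) (a, b) := by
      have h1 : ContinuousAt (fun p : EuclideanSpace ℝ (Fin 2) × EuclideanSpace ℝ (Fin 2) =>
        p.1 - p.2) (a, b) := (continuous_fst.sub continuous_snd).continuousAt
      have h2 : ContinuousAt (fun p : EuclideanSpace ℝ (Fin 2) × EuclideanSpace ℝ (Fin 2) =>
        ‖p.1 - p.2‖⁻¹) (a, b) := h1.norm.inv₀ (norm_ne_zero_iff.mpr (sub_ne_zero.mpr hab))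
      exact h2.smul h1
    have hint : ContinuousAt (fun p : EuclideanSpace ℝ (Fin 2) × EuclideanSpace ℝ (Fin 2) =>
        ∫ r in (0:ℝ)..1, σ (p.1 - r • (p.1 - p.2)) (‖p.1 - p.2‖⁻¹ • (p.1 - p.2))) (a, b) := by
      refine intervalIntegral.continuousAt_of_dominated_interval (bound := fun _ => M) ?_ ?_
        intervalIntegrable_const ?_
      · filter_upwards [hopen] with p hp
        refine Continuous.aestronglyMeasurable ?_
        exact hσc.comp_continuous
          (f := fun r : ℝ => (p.1 - r • (p.1 - p.2), ‖p.1 - p.2‖⁻¹ • (p.1 - p.2)))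
          (by fun_prop)
          (fun r => ⟨mem_univ _, inv_norm_smul_mem_unitSphere (sub_ne_zero.mpr hp)⟩)
      · filter_upwards [hopen] with p hp
        exact Filter.Eventually.of_forall fun r _ =>
          hM _ _ (inv_norm_smul_mem_unitSphere (sub_ne_zero.mpr hp))
      · refine Filter.Eventually.of_forall fun r _ => ?_
        refine ContinuousWithinAt.tendsto
          (hσc (a - r • (a - b), ‖a - b‖⁻¹ • (a - b))
            ⟨mem_univ _, inv_norm_smul_mem_unitSphere (sub_ne_zero.mpr hab)⟩) |>.comp
          (f := fun p : EuclideanSpace ℝ (Fin 2) × EuclideanSpace ℝ (Fin 2) =>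
            (p.1 - r • (p.1 - p.2), ‖p.1 - p.2‖⁻¹ • (p.1 - p.2))) ?_
        refine tendsto_nhdsWithin_iff.mpr ⟨?_, ?_⟩
        · have h1 : Continuous (fun p : EuclideanSpace ℝ (Fin 2) × EuclideanSpace ℝ (Fin 2) =>
            p.1 - r • (p.1 - p.2)) := by fun_prop
          exact h1.continuousAt.prodMk hdir
        · filter_upwards [hopen] with p hp
          exact ⟨mem_univ _, inv_norm_smul_mem_unitSphere (sub_ne_zero.mpr hp)⟩
    have hnorm : ContinuousAt (fun p : EuclideanSpace ℝ (Fin 2) × EuclideanSpace ℝ (Fin 2) =>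
        ‖p.1 - p.2‖) (a, b) := Continuous.continuousAt (by fun_prop)
    refine ((hnorm.mul hint).neg.rexp).congr ?_
    filter_upwards [hopen] with p hp
    exact (attenuation_eq_exp_unitInterval σ p.1 p.2 hp).symm

theorem continuousOn_sigmaA
    {σ : EuclideanSpace ℝ (Fin 2) → EuclideanSpace ℝ (Fin 2) → ℝ}
    {k : EuclideanSpace ℝ (Fin 2) → EuclideanSpace ℝ (Fin 2) → EuclideanSpace ℝ (Fin 2) → ℝ}
    (hσc : ContinuousOn (fun p : EuclideanSpace ℝ (Fin 2) × EuclideanSpace ℝ (Fin 2) =>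
      σ p.1 p.2) (Set.univ ×ˢ Metric.sphere 0 1))
    (hkc : ContinuousOn (fun p : EuclideanSpace ℝ (Fin 2) ×
      EuclideanSpace ℝ (Fin 2) × EuclideanSpace ℝ (Fin 2) => k p.1 p.2.1 p.2.2)
      (Set.univ ×ˢ Metric.sphere 0 1 ×ˢ Metric.sphere 0 1))
    {M : ℝ} (hM : ∀ x v v₁ : EuclideanSpace ℝ (Fin 2),
      v ∈ Metric.sphere (0 : EuclideanSpace ℝ (Fin 2)) 1 →
      v₁ ∈ Metric.sphere (0 : EuclideanSpace ℝ (Fin 2)) 1 → |k x v v₁| ≤ M) :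
    ContinuousOn (fun p : EuclideanSpace ℝ (Fin 2) × EuclideanSpace ℝ (Fin 2) =>
      sigmaA σ k p.1 p.2) (Set.univ ×ˢ Metric.sphere 0 1) := by
  refine hσc.sub fun p hp => ?_
  refine continuousWithinAt_of_dominated (bound := fun _ => M) ?_ ?_ (integrable_const M) ?_
  · filter_upwards [self_mem_nhdsWithin] with q hq
    refine Continuous.aestronglyMeasurable ?_
    exact hkc.comp_continuous
      (f := fun u : Metric.sphere (0 : EuclideanSpace ℝ (Fin 2)) 1 =>
        (q.1, q.2, (u : EuclideanSpace ℝ (Fin 2))))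
      (by fun_prop) (fun u => ⟨mem_univ _, hq.2, u.2⟩)
  · filter_upwards [self_mem_nhdsWithin] with q hq
    exact Filter.Eventually.of_forall fun u => hM _ _ _ hq.2 u.2
  · refine Filter.Eventually.of_forall fun u => ?_
    refine (hkc.comp (s := Set.univ ×ˢ Metric.sphere (0 : EuclideanSpace ℝ (Fin 2)) 1)
      (f := fun q : EuclideanSpace ℝ (Fin 2) × EuclideanSpace ℝ (Fin 2) =>
        (q.1, q.2, (u : EuclideanSpace ℝ (Fin 2)))) ?_ ?_) p hp
    · exact Continuous.continuousOn (by fun_prop)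
    · exact fun q hq => ⟨mem_univ _, hq.2, u.2⟩

theorem tendsto_arsinh_mul_exp_div_atTop {c : ℝ} (hc : 0 < c) :
    Filter.Tendsto (fun l : ℝ => arsinh (c * Real.exp l) / l) Filter.atTop (nhds 1) := by
  have hformula : ∀ l : ℝ, arsinh (c * Real.exp l) =
      l + Real.log (c + √(Real.exp (-l) ^ 2 + c ^ 2)) := by
    intro l
    have hpos : 0 < c + √(Real.exp (-l) ^ 2 + c ^ 2) := by positivity
    have h1 : 1 + (c * Real.exp l) ^ 2 = Real.exp l ^ 2 * (Real.exp (-l) ^ 2 + c ^ 2) := by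
      rw [mul_add, ← mul_pow, ← Real.exp_add]
      simp
      ring
    rw [arsinh, h1, Real.sqrt_mul (by positivity), Real.sqrt_sq (Real.exp_pos l).le]
    rw [show c * Real.exp l + Real.exp l * √(Real.exp (-l) ^ 2 + c ^ 2) =
      Real.exp l * (c + √(Real.exp (-l) ^ 2 + c ^ 2)) by ring,
      Real.log_mul (Real.exp_pos l).ne' hpos.ne', Real.log_exp]
  have hexp : Filter.Tendsto (fun l : ℝ => Real.exp (-l)) Filter.atTop (nhds 0) :=
    Real.tendsto_exp_neg_atTop_nhds_zero
  have hlog : Filter.Tendsto (fun l : ℝ => Real.log (c + √(Real.exp (-l) ^ 2 + c ^ 2)))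
      Filter.atTop (nhds (Real.log (c + √(0 ^ 2 + c ^ 2)))) :=
    ((((hexp.pow 2).add_const _).sqrt).const_add c).log (by positivity)
  have hquot := (hlog.div_atTop Filter.tendsto_id).const_add 1
  rw [add_zero] at hquot
  refine hquot.congr' ?_
  filter_upwards [Filter.eventually_gt_atTop 0] with l hl
  rw [hformula l, add_div, div_self hl.ne', id]

theorem tendsto_exp_neg_mul_sinh_mul {s : ℝ} (hs : |s| < 1) :
    Filter.Tendsto (fun l : ℝ => Real.exp (-l) * Real.sinh (l * s)) Filter.atTop (nhds 0) := by
  have key : ∀ r : ℝ, r < 1 →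
      Filter.Tendsto (fun l : ℝ => Real.exp (-l + l * r)) Filter.atTop (nhds 0) := by
    intro r hr
    refine Real.tendsto_exp_atBot.comp ?_
    have h := Filter.tendsto_id.const_mul_atTop_of_neg (r := r - 1) (l := Filter.atTop) (by linarith)
    exact h.congr fun l => by simp only [id]; ring
  obtain ⟨h1, h2⟩ := abs_lt.mp hs
  have h := ((key s h2).sub (key (-s) (by linarith))).div_const 2
  rw [sub_zero, zero_div] at h
  refine h.congr fun l => ?_
  rw [Real.sinh_eq, Real.exp_add, Real.exp_add, mul_neg]
  ring

theorem tendsto_inv_cosh_atTop :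
    Filter.Tendsto (fun y : ℝ => (Real.cosh y)⁻¹) Filter.atTop (nhds 0) := by
  refine Filter.Tendsto.inv_tendsto_atTop ?_
  refine Filter.tendsto_atTop_mono (fun y => ?_) (Real.tendsto_exp_atTop.atTop_div_const two_pos)
  rw [Real.cosh_eq]
  have := Real.exp_pos (-y)
  linarith

theorem tendsto_inv_cosh_mul_sinh_atTop :
    Filter.Tendsto (fun y : ℝ => (Real.cosh y)⁻¹ * Real.sinh y) Filter.atTop (nhds 1) := by
  have h := (Real.tendsto_exp_neg_atTop_nhds_zero.mul tendsto_inv_cosh_atTop).const_sub 1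
  rw [mul_zero, sub_zero] at h
  refine h.congr fun y => ?_
  have := (Real.cosh_pos y).ne'
  rw [← Real.cosh_sub_sinh]
  field_simp
  ring

section HyperbolicDirection

variable {V : Type*} [NormedAddCommGroup V] [InnerProductSpace ℝ V]

/-- The direction from the point at signed distance `sinh y` along `v` to the point `w`. -/
noncomputable def hyperbolicDirection (v w : V) (y : ℝ) : V :=
  (Real.cosh y)⁻¹ • ((-Real.sinh y) • v + w)

theorem continuous_hyperbolicDirection (v w : V) : Continuous (hyperbolicDirection v w) := by
  unfold hyperbolicDirection
  refine (Real.continuous_cosh.inv₀ fun y => (Real.cosh_pos y).ne').smul ?_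
  exact (Real.continuous_sinh.neg.smul continuous_const).add continuous_const

theorem hyperbolicDirection_mem_sphere {v w : V} (hv : ‖v‖ = 1) (hw : ‖w‖ = 1)
    (hwv : ⟪w, v⟫ = 0) (y : ℝ) : hyperbolicDirection v w y ∈ Metric.sphere (0 : V) 1 := by
  have hsq : ‖(-Real.sinh y) • v + w‖ ^ 2 = Real.cosh y ^ 2 := by
    rw [norm_add_sq_real, inner_smul_left, real_inner_comm, hwv, norm_smul, hv, hw, Real.cosh_sq]
    simp
  have hcosh := Real.cosh_pos y
  rw [mem_sphere_zero_iff_norm, hyperbolicDirection, norm_smul,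
    (sq_eq_sq₀ (norm_nonneg _) hcosh.le).mp hsq, norm_inv, Real.norm_of_nonneg hcosh.le,
    inv_mul_cancel₀ hcosh.ne']

theorem tendsto_hyperbolicDirection_atTop (v w : V) :
    Filter.Tendsto (hyperbolicDirection v w) Filter.atTop (nhds (-v)) := by
  have h := (tendsto_inv_cosh_mul_sinh_atTop.neg.smul_const v).add
    (tendsto_inv_cosh_atTop.smul_const w)
  rw [neg_one_smul, zero_smul, add_zero] at h
  refine h.congr fun y => ?_
  rw [hyperbolicDirection, smul_add, smul_smul, mul_neg]

theorem tendsto_hyperbolicDirection_atBot (v w : V) :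
    Filter.Tendsto (hyperbolicDirection v w) Filter.atBot (nhds v) := by
  have h := (tendsto_hyperbolicDirection_atTop (-v) w).comp Filter.tendsto_neg_atBot_atTop
  rw [neg_neg] at h
  refine h.congr fun y => ?_
  simp [hyperbolicDirection]

theorem tendsto_integral_hyperbolicDirection [ProperSpace V] {v w : V} (hv : ‖v‖ = 1)
    (hw : ‖w‖ = 1) (hwv : ⟪w, v⟫ = 0) (x : V) {c d : ℝ} (hc : 0 < c) (hd : 0 < d)
    {Φ : V × V × V → ℝ} (hΦ : ContinuousOn Φ (univ ×ˢ univ ×ˢ Metric.sphere 0 1)) :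
    Filter.Tendsto (fun l : ℝ => ∫ s in
        (-(arsinh (c * Real.exp l) / l))..(arsinh (d * Real.exp l) / l),
        Φ (x + Real.exp (-l) • w, x + (Real.exp (-l) * Real.sinh (l * s)) • v,
          hyperbolicDirection v w (l * s)))
      Filter.atTop (nhds (Φ (x, x, v) + Φ (x, x, -v))) := by
  set K : Set (V × V × V) :=
    Metric.closedBall x 1 ×ˢ Metric.closedBall x (max c d) ×ˢ Metric.sphere 0 1
  have hKc : IsCompact K := (isCompact_closedBall _ _).prod
    ((isCompact_closedBall _ _).prod (isCompact_sphere _ _))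
  obtain ⟨C, hC⟩ := hKc.exists_bound_of_continuousOn
    (hΦ.mono (prod_mono (subset_univ _) (prod_mono (subset_univ _) subset_rfl)))
  have hmemS := hyperbolicDirection_mem_sphere hv hw hwv
  have hvS : v ∈ Metric.sphere (0 : V) 1 := by simp [hv]
  have hC0 : 0 ≤ C := (norm_nonneg _).trans (hC (x, x, v)
    ⟨by simp, by simp [hc.le], hvS⟩)
  set A : ℝ → ℝ := fun l => arsinh (c * Real.exp l) / l
  set B : ℝ → ℝ := fun l => arsinh (d * Real.exp l) / l
  have hA : Filter.Tendsto A Filter.atTop (nhds 1) := tendsto_arsinh_mul_exp_div_atTop hc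
  have hB : Filter.Tendsto B Filter.atTop (nhds 1) := tendsto_arsinh_mul_exp_div_atTop hd
  set F : ℝ → ℝ → ℝ := fun l s =>
    Φ (x + Real.exp (-l) • w, x + (Real.exp (-l) * Real.sinh (l * s)) • v,
      hyperbolicDirection v w (l * s))
  have hFc : ∀ l, Continuous (F l) := fun l => hΦ.comp_continuous
    (f := fun s : ℝ => (x + Real.exp (-l) • w, x + (Real.exp (-l) * Real.sinh (l * s)) • v,
      hyperbolicDirection v w (l * s)))
    (by
      have := continuous_hyperbolicDirection v w
      fun_prop)
    fun s => ⟨mem_univ _, mem_univ _, hmemS _⟩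
  set f : ℝ → ℝ := fun s => (Ioc (-1) 0).indicator (fun _ => Φ (x, x, v)) s +
    (Ioc 0 1).indicator (fun _ => Φ (x, x, -v)) s
  have hfint : ∫ s, f s = Φ (x, x, v) + Φ (x, x, -v) := by
    rw [integral_add, integral_indicator_const _ measurableSet_Ioc,
      integral_indicator_const _ measurableSet_Ioc]
    · simp
    · exact (integrable_indicator_iff measurableSet_Ioc).mpr (integrableOn_const (by simp))
    · exact (integrable_indicator_iff measurableSet_Ioc).mpr (integrableOn_const (by simp))
  have hint : ∀ᶠ l in Filter.atTop,
      ∫ s, (Ioc (-A l) (B l)).indicator (F l) s = ∫ s in (-A l)..(B l), F l s := by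
    filter_upwards [hA.eventually_const_lt zero_lt_one, hB.eventually_const_lt zero_lt_one]
      with l hAl hBl
    rw [intervalIntegral.integral_of_le (by linarith), integral_indicator measurableSet_Ioc]
  rw [← hfint]
  refine Filter.Tendsto.congr' hint ?_
  refine tendsto_integral_filter_of_dominated_convergence
    ((Ioc (-2) 2).indicator fun _ => C) ?_ ?_ ?_ ?_
  · exact Filter.Eventually.of_forall fun l =>
      (hFc l).aestronglyMeasurable.indicator measurableSet_Ioc
  · filter_upwards [hA.eventually_lt_const one_lt_two, hB.eventually_lt_const one_lt_two,
      Filter.eventually_gt_atTop 0] with l hAl hBl hl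
    refine Filter.Eventually.of_forall fun s => ?_
    by_cases hs : s ∈ Ioc (-A l) (B l)
    · rw [indicator_of_mem hs, indicator_of_mem (show s ∈ Ioc (-2) 2 from
        ⟨by linarith [hs.1], by linarith [hs.2]⟩)]
      refine hC _ ⟨?_, ?_, hmemS _⟩
      · simp [norm_smul, hw, hl.le]
      · have hlo : -(arsinh (c * Real.exp l)) ≤ l * s := by
          have := (lt_div_iff₀ hl).mp (neg_lt.mp hs.1)
          linarith
        have hhi : l * s ≤ arsinh (d * Real.exp l) := by
          have := (le_div_iff₀ hl).mp hs.2
          linarith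
        have hlo' := Real.sinh_le_sinh.mpr hlo
        have hhi' := Real.sinh_le_sinh.mpr hhi
        rw [Real.sinh_neg, Real.sinh_arsinh] at hlo'
        rw [Real.sinh_arsinh] at hhi'
        have hexp : Real.exp (-l) * Real.exp l = 1 := by rw [← Real.exp_add]; simp
        have hpos := Real.exp_pos (-l)
        have h1 := mul_le_mul_of_nonneg_left hlo' hpos.le
        have h2 := mul_le_mul_of_nonneg_left hhi' hpos.le
        have h3 : Real.exp (-l) * -(c * Real.exp l) = -c := by linear_combination (-c) * hexp
        have h4 : Real.exp (-l) * (d * Real.exp l) = d := by linear_combination d * hexp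
        have h5 : |Real.exp (-l) * Real.sinh (l * s)| ≤ max c d :=
          abs_le.mpr ⟨by linarith [le_max_left c d], by linarith [le_max_right c d]⟩
        simpa only [mem_closedBall_iff_norm, add_sub_cancel_left, norm_smul, hv, mul_one,
          Real.norm_eq_abs] using h5
    · rw [indicator_of_notMem hs, norm_zero]
      exact indicator_nonneg (fun _ _ => hC0) _
  · exact (integrable_indicator_iff measurableSet_Ioc).mpr (integrableOn_const (by simp))
  · have hpt : ∀ s : ℝ, ∀ v₀ ∈ Metric.sphere (0 : V) 1, |s| < 1 →
        Filter.Tendsto (fun l => hyperbolicDirection v w (l * s)) Filter.atTop (nhds v₀) →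
        Filter.Tendsto (fun l => F l s) Filter.atTop (nhds (Φ (x, x, v₀))) := by
      intro s v₀ hv₀ hs hdir
      refine (hΦ (x, x, v₀) ⟨mem_univ _, mem_univ _, hv₀⟩).tendsto.comp
        (f := fun l : ℝ => (x + Real.exp (-l) • w,
          x + (Real.exp (-l) * Real.sinh (l * s)) • v, hyperbolicDirection v w (l * s))) ?_
      refine tendsto_nhdsWithin_iff.mpr ⟨?_, Filter.Eventually.of_forall fun l =>
        ⟨mem_univ _, mem_univ _, hmemS _⟩⟩
      have h1 := (Real.tendsto_exp_neg_atTop_nhds_zero.smul_const w).const_add x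
      have h2 := ((tendsto_exp_neg_mul_sinh_mul hs).smul_const v).const_add x
      rw [zero_smul, add_zero] at h1 h2
      exact h1.prodMk_nhds (h2.prodMk_nhds hdir)
    have hnull : ∀ᵐ s : ℝ, s ∉ ({-1, 0, 1} : Set ℝ) :=
      measure_eq_zero_iff_ae_notMem.mp ((Set.toFinite _).measure_zero _)
    filter_upwards [hnull] with s hs
    simp only [mem_insert_iff, mem_singleton_iff, not_or] at hs
    obtain ⟨hs1, hs0, hs2⟩ := hs
    rcases lt_or_ge 1 |s| with h | h
    · have hf0 : f s = 0 := by
        have e1 : s ∉ Ioc (-1 : ℝ) 0 := fun hm =>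
          absurd h (not_lt.mpr (abs_le.mpr ⟨hm.1.le, by linarith [hm.2]⟩))
        have e2 : s ∉ Ioc (0 : ℝ) 1 := fun hm =>
          absurd h (not_lt.mpr (abs_le.mpr ⟨by linarith [hm.1], hm.2⟩))
        simp only [f, indicator_of_notMem e1, indicator_of_notMem e2, add_zero]
      rw [hf0]
      refine tendsto_const_nhds.congr' ?_
      filter_upwards [hA.eventually_lt_const h, hB.eventually_lt_const h] with l hAl hBl
      refine (indicator_of_notMem (fun hm => ?_) _).symm
      rcases abs_cases s with ⟨e, _⟩ | ⟨e, _⟩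
      · linarith [hm.2]
      · linarith [hm.1]
    · have hlt : |s| < 1 := by
        refine lt_of_le_of_ne h fun he => ?_
        rcases abs_cases s with ⟨e, _⟩ | ⟨e, _⟩
        · exact hs2 (by linarith)
        · exact hs1 (by linarith)
      have hind : ∀ᶠ l in Filter.atTop, F l s = (Ioc (-A l) (B l)).indicator (F l) s := by
        filter_upwards [hA.eventually_const_lt hlt, hB.eventually_const_lt hlt] with l hAl hBl
        have hm : s ∈ Ioc (-A l) (B l) :=
          ⟨by linarith [neg_abs_le s], by linarith [le_abs_self s]⟩
        exact (indicator_of_mem hm _).symm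
      refine Filter.Tendsto.congr' hind ?_
      obtain ⟨hm1, h1⟩ := abs_lt.mp hlt
      rcases lt_or_gt_of_ne hs0 with hneg | hpos
      · have hf0 : f s = Φ (x, x, v) := by
          have e1 : s ∈ Ioc (-1 : ℝ) 0 := ⟨hm1, hneg.le⟩
          have e2 : s ∉ Ioc (0 : ℝ) 1 := fun hm => absurd hm.1 (not_lt.mpr hneg.le)
          simp only [f, indicator_of_mem e1, indicator_of_notMem e2, add_zero]
        rw [hf0]
        exact hpt s v hvS hlt ((tendsto_hyperbolicDirection_atBot v w).comp
          (Filter.tendsto_id.atTop_mul_const_of_neg hneg))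
      · have hf0 : f s = Φ (x, x, -v) := by
          have e1 : s ∉ Ioc (-1 : ℝ) 0 := fun hm => absurd hm.2 (not_le.mpr hpos)
          have e2 : s ∈ Ioc (0 : ℝ) 1 := ⟨hpos, h1.le⟩
          simp only [f, indicator_of_notMem e1, indicator_of_mem e2, zero_add]
        rw [hf0]
        exact hpt s (-v) (by simp [hv]) hlt ((tendsto_hyperbolicDirection_atTop v w).comp
          (Filter.tendsto_id.atTop_mul_const hpos))

/-- The substitution `t = t₀ + ε sinh (l s)`. -/
theorem integral_div_log_eq_integral_hyperbolicDirection {v w : V} (hv : ‖v‖ = 1)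
    (hw : ‖w‖ = 1) (hwv : ⟪w, v⟫ = 0) (x' : V) {t₀ τ ε l : ℝ} (hε : 0 < ε) (hl : 0 < l)
    {Φ : V × V × V → ℝ} (hΦ : ContinuousOn Φ (univ ×ˢ univ ×ˢ Metric.sphere 0 1)) :
    (∫ t in (0:ℝ)..τ, Φ (x' + t₀ • v + ε • w, x' + t • v,
        (√((t₀ - t) ^ 2 + ε ^ 2))⁻¹ • ((t₀ - t) • v + ε • w)) *
        ((t - t₀) ^ 2 + ε ^ 2) ^ (-((1:ℝ) / 2))) / l =
      ∫ s in (-(arsinh (t₀ / ε) / l))..(arsinh ((τ - t₀) / ε) / l),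
        Φ (x' + t₀ • v + ε • w, x' + t₀ • v + (ε * Real.sinh (l * s)) • v,
          hyperbolicDirection v w (l * s)) := by
  have hdir : ∀ t, (√((t₀ - t) ^ 2 + ε ^ 2))⁻¹ • ((t₀ - t) • v + ε • w) =
      hyperbolicDirection v w (arsinh ((t - t₀) / ε)) := by
    intro t
    have hsqrt : √((t₀ - t) ^ 2 + ε ^ 2) = ε * Real.cosh (arsinh ((t - t₀) / ε)) := by
      rw [Real.cosh_arsinh, ← Real.sqrt_sq hε.le, ← Real.sqrt_mul (by positivity),
        Real.sqrt_sq hε.le]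
      congr 1
      field_simp
      ring
    rw [hyperbolicDirection, hsqrt, Real.sinh_arsinh, mul_inv, mul_comm, mul_smul]
    congr 1
    rw [smul_add, smul_smul, smul_smul, inv_mul_cancel₀ hε.ne', one_smul]
    congr 2
    field_simp
    ring
  simp only [hdir]
  set g : ℝ → ℝ := fun t => Φ (x' + t₀ • v + ε • w, x' + t • v,
        hyperbolicDirection v w (arsinh ((t - t₀) / ε))) *
        ((t - t₀) ^ 2 + ε ^ 2) ^ (-((1:ℝ) / 2)) with hg
  have hgc : Continuous g := by
    refine Continuous.mul ?_ ?_
    · refine hΦ.comp_continuous (f := fun t : ℝ => (x' + t₀ • v + ε • w, x' + t • v,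
        hyperbolicDirection v w (arsinh ((t - t₀) / ε)))) ?_
        fun t => ⟨mem_univ _, mem_univ _, hyperbolicDirection_mem_sphere hv hw hwv _⟩
      have h1 := (continuous_hyperbolicDirection v w).comp (Real.continuous_arsinh.comp
        (show Continuous fun t : ℝ => (t - t₀) / ε by fun_prop))
      exact continuous_const.prodMk ((by fun_prop : Continuous fun t : ℝ => x' + t • v).prodMk h1)
    · exact Continuous.rpow_const (by fun_prop) fun t => Or.inl (by positivity)
  have hsub := intervalIntegral.integral_comp_mul_deriv (g := g)
    (a := -(arsinh (t₀ / ε) / l)) (b := arsinh ((τ - t₀) / ε) / l)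
    (f := fun s => t₀ + ε * Real.sinh (l * s)) (f' := fun s => ε * (Real.cosh (l * s) * l))
    (fun s _ => ((((hasDerivAt_id s).const_mul l).sinh.const_mul ε).const_add t₀).congr_deriv
      (by simp))
    (by fun_prop) hgc
  have e1 : t₀ + ε * Real.sinh (l * -(arsinh (t₀ / ε) / l)) = 0 := by
    rw [mul_neg, mul_div_cancel₀ _ hl.ne', Real.sinh_neg, Real.sinh_arsinh]
    field_simp
    ring
  have e2 : t₀ + ε * Real.sinh (l * (arsinh ((τ - t₀) / ε) / l)) = τ := by
    rw [mul_div_cancel₀ _ hl.ne', Real.sinh_arsinh]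
    field_simp
    ring
  rw [e1, e2] at hsub
  rw [← hsub, ← intervalIntegral.integral_div]
  congr 1
  ext s
  have hcosh := Real.cosh_pos (l * s)
  have hpow : ((ε * Real.sinh (l * s)) ^ 2 + ε ^ 2) ^ (-((1:ℝ) / 2)) =
      (ε * Real.cosh (l * s))⁻¹ := by
    rw [Real.rpow_neg (by positivity), ← Real.sqrt_eq_rpow]
    congr 1
    rw [← Real.sqrt_sq (mul_pos hε hcosh).le]
    congr 1
    rw [mul_pow ε (Real.cosh _), Real.cosh_sq]
    ring
  simp only [Function.comp, hg, add_sub_cancel_left, hpow, mul_div_cancel_left₀ _ hε.ne',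
    Real.arsinh_sinh, add_smul, add_assoc]
  field_simp

end HyperbolicDirection

/-- Asymptotics of the single-scattering kernel near the ballistic segment in dimension `n = 2`:
`L(ε)/ln(1/ε) → E(x,x') (σ_a(x,v') k(x,v',v') + σ_a(x,−v') k(x,v',−v'))` as `ε → 0⁺`. -/
theorem single_scattering_asymptotics_dim_two
    (X : Set (EuclideanSpace ℝ (Fin 2))) (hXne : X.Nonempty)
    (hXb : Bornology.IsBounded X) (hXc : Convex ℝ X) (hXo : IsOpen X)
    (σ : EuclideanSpace ℝ (Fin 2) → EuclideanSpace ℝ (Fin 2) → ℝ)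
    (k : EuclideanSpace ℝ (Fin 2) → EuclideanSpace ℝ (Fin 2) →
      EuclideanSpace ℝ (Fin 2) → ℝ)
    (hσc : ContinuousOn (fun p : EuclideanSpace ℝ (Fin 2) × EuclideanSpace ℝ (Fin 2) =>
      σ p.1 p.2) (Set.univ ×ˢ Metric.sphere 0 1))
    (hσb : ∃ M : ℝ, ∀ x v : EuclideanSpace ℝ (Fin 2),
      v ∈ Metric.sphere (0 : EuclideanSpace ℝ (Fin 2)) 1 → |σ x v| ≤ M)
    (hkc : ContinuousOn (fun p : EuclideanSpace ℝ (Fin 2) ×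
      EuclideanSpace ℝ (Fin 2) × EuclideanSpace ℝ (Fin 2) => k p.1 p.2.1 p.2.2)
      (Set.univ ×ˢ Metric.sphere 0 1 ×ˢ Metric.sphere 0 1))
    (hkb : ∃ M : ℝ, ∀ x v v₁ : EuclideanSpace ℝ (Fin 2),
      v ∈ Metric.sphere (0 : EuclideanSpace ℝ (Fin 2)) 1 →
      v₁ ∈ Metric.sphere (0 : EuclideanSpace ℝ (Fin 2)) 1 → |k x v v₁| ≤ M)
    (x' : EuclideanSpace ℝ (Fin 2)) (hx' : x' ∈ closure X)
    (v' : EuclideanSpace ℝ (Fin 2)) (hv' : ‖v'‖ = 1)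
    (henter : ∃ s : ℝ, 0 < s ∧ x' + s • v' ∈ X)
    (τ : ℝ) (hτ : τ = sSup {s : ℝ | 0 < s ∧ x' + s • v' ∈ X})
    (t₀ : ℝ) (ht₀ : t₀ ∈ Set.Ioo 0 τ)
    (x : EuclideanSpace ℝ (Fin 2)) (hx : x = x' + t₀ • v')
    (w : EuclideanSpace ℝ (Fin 2)) (hw : ‖w‖ = 1) (hwv : ⟪w, v'⟫ = 0)
    (L : ℝ → ℝ)
    (hL : ∀ ε : ℝ, 0 < ε → L ε =
      ∫ t' in (0:ℝ)..τ,
        attenuation σ (x + ε • w) (x' + t' • v') * attenuation σ (x' + t' • v') x' *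
        sigmaA σ k (x + ε • w)
          ((Real.sqrt ((t₀ - t')^2 + ε^2))⁻¹ • ((t₀ - t') • v' + ε • w)) *
        k (x' + t' • v') v'
          ((Real.sqrt ((t₀ - t')^2 + ε^2))⁻¹ • ((t₀ - t') • v' + ε • w)) *
        ((t' - t₀)^2 + ε^2) ^ (-((1:ℝ)/2))) :
    Filter.Tendsto (fun ε : ℝ => L ε / Real.log (1/ε)) (nhdsWithin 0 (Set.Ioi 0))
      (nhds (attenuation σ x x' *
        (sigmaA σ k x v' * k x v' v' + sigmaA σ k x (-v') * k x v' (-v')))) := by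
  subst hx
  obtain ⟨Mσ, hMσ⟩ := hσb
  obtain ⟨Mk, hMk⟩ := hkb
  have hvS : v' ∈ Metric.sphere (0 : EuclideanSpace ℝ (Fin 2)) 1 := by simp [hv']
  have hE := continuous_attenuation hσc hMσ
  have hσa := continuousOn_sigmaA hσc hkc hMk
  set Φ : EuclideanSpace ℝ (Fin 2) × EuclideanSpace ℝ (Fin 2) × EuclideanSpace ℝ (Fin 2) → ℝ :=
    fun p => attenuation σ p.1 p.2.1 * attenuation σ p.2.1 x' * sigmaA σ k p.1 p.2.2 *
      k p.2.1 v' p.2.2 with hΦdef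
  have hΦ : ContinuousOn Φ (univ ×ˢ univ ×ˢ Metric.sphere 0 1) := by
    refine ((Continuous.continuousOn ?_).mul ?_).mul ?_
    · exact (hE.comp (f := fun p : EuclideanSpace ℝ (Fin 2) × EuclideanSpace ℝ (Fin 2) ×
        EuclideanSpace ℝ (Fin 2) => (p.1, p.2.1)) (by fun_prop)).mul
        (hE.comp (f := fun p : EuclideanSpace ℝ (Fin 2) × EuclideanSpace ℝ (Fin 2) ×
        EuclideanSpace ℝ (Fin 2) => (p.2.1, x')) (by fun_prop))
    · exact hσa.comp (f := fun p : EuclideanSpace ℝ (Fin 2) × EuclideanSpace ℝ (Fin 2) ×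
        EuclideanSpace ℝ (Fin 2) => (p.1, p.2.2)) (Continuous.continuousOn (by fun_prop))
        fun p hp => ⟨mem_univ _, hp.2.2⟩
    · exact hkc.comp (f := fun p : EuclideanSpace ℝ (Fin 2) × EuclideanSpace ℝ (Fin 2) ×
        EuclideanSpace ℝ (Fin 2) => (p.2.1, v', p.2.2)) (Continuous.continuousOn (by fun_prop))
        fun p hp => ⟨mem_univ _, hvS, hp.2.2⟩
  have hlim := tendsto_integral_hyperbolicDirection hv' hw hwv (x' + t₀ • v') ht₀.1 (sub_pos.mpr ht₀.2) hΦ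
  have hval : ∀ x, Φ (x, x, v') + Φ (x, x, -v') = attenuation σ x x' *
      (sigmaA σ k x v' * k x v' v' + sigmaA σ k x (-v') * k x v' (-v')) := by
    intro x
    simp only [hΦdef, attenuation_self]
    ring
  rw [hval] at hlim
  have hlog : Filter.Tendsto (fun ε : ℝ => Real.log (1 / ε)) (nhdsWithin 0 (Ioi 0))
      Filter.atTop := by
    simpa only [one_div, Function.comp_def] using Real.tendsto_log_atTop.comp tendsto_inv_nhdsGT_zero
  refine (hlim.comp hlog).congr' ?_
  filter_upwards [self_mem_nhdsWithin, hlog.eventually_gt_atTop 0] with ε hε hl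
  have hε' : 0 < ε := hε
  have hexp : Real.exp (Real.log (1 / ε)) = ε⁻¹ := by
    rw [Real.exp_log (by positivity), one_div]
  rw [hL ε hε']
  refine Eq.trans ?_
    (integral_div_log_eq_integral_hyperbolicDirection hv' hw hwv x' hε' hl hΦ).symm
  simp only [Function.comp, Real.exp_neg, hexp, inv_inv, ← div_eq_mul_inv]
end
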